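/- arXiv:math/0611293 — 2 statements merged into one kernel-verified Lean document; each statement's English description precedes it below -/
import Mathlib

section
/- Let a and b be integers, each at least 10. Then a _ b ≥ max{a, b}. -/
/-- The dungeon operation: interpret the base-10 digits of `a` in base `b`. -/
def dungeon (a b : ℕ) : ℕ := Nat.ofDigits b (Nat.digits 10 a)

theorem left_le_dungeon (a : ℕ) {b : ℕ} (hb : 10 ≤ b) : a ≤ dungeon a b := by
  simpa only [dungeon, Nat.ofDigits_digits] using Nat.ofDigits_monotone (Nat.digits 10 a) hb

theorem dungeon_eq_mod_add {a : ℕ} (b : ℕ) (ha : 0 < a) :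
    dungeon a b = a % 10 + b * dungeon (a / 10) b := by
  simp only [dungeon]
  rw [Nat.digits_def' (by norm_num) ha, Nat.ofDigits_cons]

theorem dungeon_ge_max (a b : ℕ) (ha : 10 ≤ a) (hb : 10 ≤ b) :
    max a b ≤ dungeon a b := by
  refine max_le (left_le_dungeon a hb) ?_
  have h : 1 ≤ dungeon (a / 10) b :=
    le_trans (by omega) (left_le_dungeon (a / 10) hb)
  rw [dungeon_eq_mod_add b (by omega)]
  exact le_add_left (Nat.le_mul_of_pos_right b h)
end

section
/- For all n ≥ 10, δ(n) ≥ γ(n), where δ(n) = e(n, 10) with e(n, n) = n and e(n, m) = e(n, m+1) _ m for 10 ≤ m < n, and γ(10) = 10, γ(n+1) = (n+1) _ γ(n). -/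
theorem dungeon_zero (b : ℕ) : dungeon 0 b = 0 := by simp [dungeon]

theorem dungeon_rec (a b : ℕ) : dungeon a b = a % 10 + b * dungeon (a / 10) b := by
  rcases Nat.eq_zero_or_pos a with rfl | h
  · simp [dungeon]
  · rw [dungeon, Nat.digits_def' (by norm_num) h, Nat.ofDigits_cons]
    simp [dungeon]

theorem dungeon_of_lt {a : ℕ} (ha : a < 10) (b : ℕ) : dungeon a b = a := by
  rw [dungeon_rec, Nat.div_eq_of_lt ha, Nat.mod_eq_of_lt ha, dungeon_zero, mul_zero, add_zero]

theorem dungeon_ten_mul (a b : ℕ) : dungeon (10 * a) b = b * dungeon a b := by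
  rw [dungeon_rec, Nat.mul_mod_right, Nat.mul_div_cancel_left _ (by norm_num), zero_add]

theorem dungeon_succ {b : ℕ} (hb : 10 ≤ b) (a : ℕ) : dungeon a b + 1 ≤ dungeon (a + 1) b := by
  induction a using Nat.strong_induction_on with
  | _ a ih =>
    rw [dungeon_rec a, dungeon_rec (a + 1)]
    by_cases h : a % 10 = 9
    · have h1 : (a + 1) / 10 = a / 10 + 1 := by omega
      have h2 := Nat.mul_le_mul_left b (ih (a / 10) (by omega))
      rw [h1]
      rw [mul_add] at h2
      omega
    · have h1 : (a + 1) / 10 = a / 10 := by omega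
      rw [h1]
      omega

theorem dungeon_add {b : ℕ} (hb : 10 ≤ b) (x y : ℕ) :
    dungeon x b + dungeon y b ≤ dungeon (x + y) b := by
  induction x using Nat.strong_induction_on generalizing y with
  | _ x ih =>
    rcases Nat.eq_zero_or_pos x with rfl | hx
    · simp [dungeon_zero]
    · have h2 := ih (x / 10) (by omega) (y / 10)
      rw [dungeon_rec x, dungeon_rec y, dungeon_rec (x + y)]
      by_cases h : x % 10 + y % 10 < 10
      · have h1 : (x + y) / 10 = x / 10 + y / 10 := by omega
        have h3 := Nat.mul_le_mul_left b h2
        rw [h1]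
        rw [mul_add] at h3
        omega
      · have h1 : (x + y) / 10 = x / 10 + y / 10 + 1 := by omega
        have h3 := Nat.mul_le_mul_left b
          ((Nat.add_le_add_right h2 1).trans (dungeon_succ hb (x / 10 + y / 10)))
        rw [h1]
        rw [mul_add, mul_add] at h3
        omega

theorem mul_dungeon_le {b : ℕ} (hb : 10 ≤ b) (r y : ℕ) :
    r * dungeon y b ≤ dungeon (r * y) b := by
  induction r with
  | zero => simp
  | succ r ih =>
    rw [add_mul, add_mul, one_mul, one_mul]
    exact (Nat.add_le_add_right ih _).trans (dungeon_add hb _ _)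

theorem dungeon_mul {b : ℕ} (hb : 10 ≤ b) (x y : ℕ) :
    dungeon x b * dungeon y b ≤ dungeon (x * y) b := by
  induction x using Nat.strong_induction_on with
  | _ x ih =>
    rcases Nat.eq_zero_or_pos x with rfl | hx
    · simp [dungeon_zero]
    · have hxy : x * y = x % 10 * y + 10 * (x / 10 * y) := by
        rw [← mul_assoc, ← add_mul, Nat.mod_add_div]
      calc dungeon x b * dungeon y b
          = x % 10 * dungeon y b + b * (dungeon (x / 10) b * dungeon y b) := by
            rw [dungeon_rec x]; ring
        _ ≤ dungeon (x % 10 * y) b + b * dungeon (x / 10 * y) b :=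
            Nat.add_le_add (mul_dungeon_le hb _ _) (Nat.mul_le_mul_left b (ih _ (by omega)))
        _ ≤ dungeon (x * y) b := by
            rw [hxy, ← dungeon_ten_mul]
            exact dungeon_add hb _ _

theorem dungeon_dungeon_le {c : ℕ} (hc : 10 ≤ c) (a b : ℕ) :
    dungeon a (dungeon b c) ≤ dungeon (dungeon a b) c := by
  induction a using Nat.strong_induction_on with
  | _ a ih =>
    rcases Nat.eq_zero_or_pos a with rfl | ha
    · simp [dungeon_zero]
    · rw [dungeon_rec a (dungeon b c), dungeon_rec a b]
      calc a % 10 + dungeon b c * dungeon (a / 10) (dungeon b c)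
          ≤ dungeon (a % 10) c + dungeon (b * dungeon (a / 10) b) c :=
            Nat.add_le_add (dungeon_of_lt (Nat.mod_lt a (by norm_num)) c).ge
              ((Nat.mul_le_mul_left _ (ih _ (by omega))).trans (dungeon_mul hc _ _))
        _ ≤ _ := dungeon_add hc _ _

theorem le_dungeon {b : ℕ} (hb : 10 ≤ b) (a : ℕ) : a ≤ dungeon a b := by
  simpa [dungeon_of_lt (show 1 < 10 by norm_num)] using mul_dungeon_le hb a 1

theorem delta_ge_gamma (e : ℕ → ℕ → ℕ) (δ γ : ℕ → ℕ)
    (hdiag : ∀ n, e n n = n)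
    (hstep : ∀ n m, 10 ≤ m → m < n → e n m = dungeon (e n (m + 1)) m)
    (hδ : ∀ n, 10 ≤ n → δ n = e n 10)
    (hγ0 : γ 10 = 10)
    (hγ : ∀ n, 10 ≤ n → γ (n + 1) = dungeon (n + 1) (γ n)) :
    ∀ n, 10 ≤ n → γ n ≤ δ n := by
  have hγ_ge : ∀ k, 10 ≤ k → 10 ≤ γ k := by
    intro k hk
    induction k, hk using Nat.le_induction with
    | base => exact hγ0.ge
    | succ k hk ih =>
      rw [hγ k hk]
      exact (show 10 ≤ k + 1 by omega).trans (le_dungeon ih _)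
  have key : ∀ n k, 10 ≤ k → k < n → dungeon (e n (k + 1)) (γ k) ≤ e n 10 := by
    intro n k hk
    induction k, hk using Nat.le_induction with
    | base =>
      intro hn
      rw [hγ0, hstep n 10 le_rfl hn]
    | succ k hk ih =>
      intro hn
      have h := ih (by omega)
      rw [hstep n (k + 1) (by omega) hn] at h
      rw [hγ k hk]
      exact (dungeon_dungeon_le (hγ_ge k hk) _ _).trans h
  intro n hn
  rw [hδ n hn]
  obtain rfl | ⟨m, hm, rfl⟩ : n = 10 ∨ ∃ m, 10 ≤ m ∧ n = m + 1 := by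
    rcases hn.eq_or_lt with h | h
    · exact Or.inl h.symm
    · exact Or.inr ⟨n - 1, by omega, by omega⟩
  · rw [hγ0, hdiag]
  · have h := key (m + 1) m hm (Nat.lt_succ_self m)
    rwa [hdiag, ← hγ m hm] at h
end
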